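/- Let A be a finite dimensional algebra over a field k that is piecewise hereditary and sincere. Then gldim A ≤ 3, and projd Q + injd Q ≤ 4 for every indecomposable module Q in mod A. -/

import Mathlib

/-!
Statement 2: a finite dimensional, piecewise hereditary, sincere algebra `A`
satisfies `gldim A ≤ 3` and `projd Q + injd Q ≤ 4` for every indecomposable
module `Q` in `mod A` (the category of finite dimensional right `A`-modules,
realized as finitely generated `Aᵐᵒᵖ`-modules).
-/

open CategoryTheory CategoryTheory.Limits

set_option synthInstance.maxHeartbeats 800000
set_option maxHeartbeats 1600000

universe w w' v' u' v₁ u₁ u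

namespace PiecewiseHereditaryPaper

section AbstractDefs

variable (𝒜 : Type u₁) [Category.{v₁} 𝒜] [Abelian 𝒜] [HasDerivedCategory.{w} 𝒜]

/-- `Ext^d(X,Y) ≠ 0`, where `Ext^d` is computed as `Hom_{D(𝒜)}(X[0], Y[0][d])`. -/
def extNonzero (X Y : 𝒜) (d : ℤ) : Prop :=
  ∃ g : (DerivedCategory.singleFunctor 𝒜 0).obj X ⟶
      (((DerivedCategory.singleFunctor 𝒜 0).obj Y)⟦d⟧), g ≠ 0

/-- The projective dimension `projd Q = sup {d : Ext^d(Q,Q') ≠ 0 for some Q'}`. -/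
noncomputable def projDim (Q : 𝒜) : ℕ∞ :=
  ⨆ (d : ℕ) (_ : ∃ Q' : 𝒜, extNonzero 𝒜 Q Q' d), (d : ℕ∞)

/-- The injective dimension `injd Q = sup {d : Ext^d(Q',Q) ≠ 0 for some Q'}`. -/
noncomputable def injDim (Q : 𝒜) : ℕ∞ :=
  ⨆ (d : ℕ) (_ : ∃ Q' : 𝒜, extNonzero 𝒜 Q' Q d), (d : ℕ∞)

/-- The global dimension `gldim = sup_Q projd Q`. -/
noncomputable def gldim : ℕ∞ := ⨆ Q : 𝒜, projDim 𝒜 Q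

/-- An abelian category is hereditary if `Ext^d` vanishes for all `d ≥ 2`. -/
def Hereditary : Prop := ∀ (X Y : 𝒜) (d : ℕ), 2 ≤ d → ¬ extNonzero 𝒜 X Y (d : ℤ)

/-- A triangulated equivalence `D(𝒜) ≃ D(ℋ)`. -/
structure TriangulatedEquivalence (ℋ : Type u') [Category.{v'} ℋ] [Abelian ℋ]
    [HasDerivedCategory.{w'} ℋ] where
  functor : DerivedCategory 𝒜 ⥤ DerivedCategory ℋ
  isEquivalence : functor.IsEquivalence
  commShift : functor.CommShift ℤ
  isTriangulated : letI := commShift; functor.IsTriangulated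

/-- `𝒜` is piecewise hereditary if there are a hereditary abelian category `ℋ`
and a triangulated equivalence `D(𝒜) ≃ D(ℋ)`. -/
def IsPiecewiseHereditary : Prop :=
  ∃ (ℋ : Type u') (_ : Category.{v'} ℋ) (_ : Abelian ℋ) (_ : HasDerivedCategory.{w'} ℋ),
    Hereditary ℋ ∧ Nonempty (TriangulatedEquivalence 𝒜 ℋ)

end AbstractDefs

section DerivedPart

open Pretriangulated Triangulated DerivedCategory DerivedCategory.TStructure

variable {ℋ : Type u'} [Category.{v'} ℋ] [Abelian ℋ] [HasDerivedCategory.{w'} ℋ]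

lemma isIso_homology_mor₁ (T : Triangle (DerivedCategory ℋ)) (hT : T ∈ distTriang _)
    (m n : ℤ) (h : m + 1 = n) (h₁ : IsZero ((homologyFunctor ℋ m).obj T.obj₃))
    (h₂ : IsZero ((homologyFunctor ℋ n).obj T.obj₃)) :
    IsIso ((homologyFunctor ℋ n).map T.mor₁) := by
  have : Mono ((homologyFunctor ℋ n).map T.mor₁) :=
    (HomologySequence.mono_homologyMap_mor₁_iff T hT m n h).2 (h₁.eq_of_src _ _)
  have : Epi ((homologyFunctor ℋ n).map T.mor₁) :=
    (HomologySequence.epi_homologyMap_mor₁_iff T hT n).2 (h₂.eq_of_tgt _ _)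
  exact isIso_of_mono_of_epi _

lemma isIso_homology_mor₂ (T : Triangle (DerivedCategory ℋ)) (hT : T ∈ distTriang _)
    (m n : ℤ) (h : m + 1 = n) (h₁ : IsZero ((homologyFunctor ℋ m).obj T.obj₁))
    (h₂ : IsZero ((homologyFunctor ℋ n).obj T.obj₁)) :
    IsIso ((homologyFunctor ℋ m).map T.mor₂) := by
  have : Mono ((homologyFunctor ℋ m).map T.mor₂) :=
    (HomologySequence.mono_homologyMap_mor₂_iff T hT m).2 (h₁.eq_of_src _ _)
  have : Epi ((homologyFunctor ℋ m).map T.mor₂) :=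
    (HomologySequence.epi_homologyMap_mor₂_iff T hT m n h).2 (h₂.eq_of_tgt _ _)
  exact isIso_of_mono_of_epi _

lemma single_hom_eq_zero_of_lt (X Y : ℋ) (a b : ℤ) (h : a < b)
    (f : (singleFunctor ℋ a).obj X ⟶ (singleFunctor ℋ b).obj Y) : f = 0 :=
  (t : TStructure (DerivedCategory ℋ)).zero_of_isLE_of_isGE f a b h inferInstance inferInstance

lemma single_hom_eq_zero_of_hereditary (hH : Hereditary ℋ) (X Y : ℋ) (a b : ℤ) (h : b + 2 ≤ a)
    (f : (singleFunctor ℋ a).obj X ⟶ (singleFunctor ℋ b).obj Y) : f = 0 := by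
  obtain ⟨d, hd⟩ : ∃ d : ℕ, (d : ℤ) = a - b := ⟨(a - b).toNat, by lia⟩
  let e₁ : ((singleFunctor ℋ a).obj X)⟦a⟧ ≅ (singleFunctor ℋ 0).obj X :=
    ((singleFunctors ℋ).shiftIso a 0 a (by lia)).app X
  let e₂ : ((singleFunctor ℋ b).obj Y)⟦a⟧ ≅ (singleFunctor ℋ (b - a)).obj Y :=
    ((singleFunctors ℋ).shiftIso a (b - a) b (by lia)).app Y
  let e₃ : ((singleFunctor ℋ 0).obj Y)⟦(d : ℤ)⟧ ≅ (singleFunctor ℋ (b - a)).obj Y :=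
    ((singleFunctors ℋ).shiftIso (d : ℤ) (b - a) 0 (by lia)).app Y
  have := hH X Y d (by lia)
  simp only [extNonzero, not_exists, not_not] at this
  have h1 := this (e₁.inv ≫ f⟦a⟧' ≫ e₂.hom ≫ e₃.inv)
  have h2 : f⟦a⟧' = 0 := by
    rw [← cancel_epi e₁.inv, ← cancel_mono (e₂.hom ≫ e₃.inv)]
    simpa using h1
  exact (shiftFunctor (DerivedCategory ℋ) a).map_injective (by simpa using h2)

lemma exists_split_aux (hH : Hereditary ℋ) (E : DerivedCategory ℋ) (n : ℤ)
    [E.IsGE (n - 1)] [E.IsLE n] : (t.truncGEδLT n).app E = 0 := by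
  have i1 : ((t.truncGE n).obj E).IsGE n := inferInstance
  have i2 : ((t.truncGE n).obj E).IsLE n := inferInstance
  have i3 : ((t.truncLT n).obj E).IsGE (n - 1) := inferInstance
  have i4 : ((t.truncLT n).obj E).IsLE (n - 1) := inferInstance
  obtain ⟨Y, ⟨e⟩⟩ := exists_iso_singleFunctor_obj_of_isGE_of_isLE ((t.truncGE n).obj E) n
  obtain ⟨Y', ⟨e'⟩⟩ := exists_iso_singleFunctor_obj_of_isGE_of_isLE ((t.truncLT n).obj E) (n - 1)
  let e₂ : ((singleFunctor ℋ (n - 1)).obj Y')⟦(1 : ℤ)⟧ ≅ (singleFunctor ℋ (n - 2)).obj Y' :=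
    ((singleFunctors ℋ).shiftIso 1 (n - 2) (n - 1) (by lia)).app Y'
  have := single_hom_eq_zero_of_hereditary hH Y Y' n (n - 2) (by lia)
    (e.inv ≫ (t.truncGEδLT n).app E ≫ e'.hom⟦(1 : ℤ)⟧' ≫ e₂.hom)
  rw [← cancel_epi e.inv, ← cancel_mono (e'.hom⟦(1 : ℤ)⟧' ≫ e₂.hom)]
  simpa using this

lemma isIso_homology_truncGEπ (E : DerivedCategory ℋ) (n : ℤ) :
    IsIso ((homologyFunctor ℋ n).map ((t.truncGEπ n).app E)) := by
  have i4 : ((t.truncLT n).obj E).IsLE (n - 1) := inferInstance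
  exact isIso_homology_mor₂ _ (t.triangleLTGE_distinguished n E) n (n + 1) rfl
    (isZero_of_isLE ((t.truncLT n).obj E) (n - 1) n (by lia))
    (isZero_of_isLE ((t.truncLT n).obj E) (n - 1) (n + 1) (by lia))

lemma isIso_homology_truncLTι (E : DerivedCategory ℋ) (n : ℤ) :
    IsIso ((homologyFunctor ℋ (n - 1)).map ((t.truncLTι n).app E)) := by
  have i4 : ((t.truncGE n).obj E).IsGE n := inferInstance
  exact isIso_homology_mor₁ _ (t.triangleLTGE_distinguished n E) (n - 2) (n - 1) (by lia)
    (isZero_of_isGE ((t.truncGE n).obj E) n (n - 2) (by lia))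
    (isZero_of_isGE ((t.truncGE n).obj E) n (n - 1) (by lia))

lemma isIso_homology_Q_map {K L : CochainComplex ℋ ℤ} (φ : K ⟶ L) (n : ℤ)
    (h₁ : Epi (φ.f (n - 1))) (h₂ : IsIso (φ.f n)) (h₃ : Mono (φ.f (n + 1))) :
    IsIso ((homologyFunctor ℋ n).map (Q.map φ)) := by
  have : IsIso (HomologicalComplex.homologyMap φ n) := by
    rw [← quasiIsoAt_iff_isIso_homologyMap,
      quasiIsoAt_iff' φ (n - 1) n (n + 1) (by simp) (by simp)]
    let ψ := (HomologicalComplex.shortComplexFunctor' ℋ _ (n - 1) n (n + 1)).map φ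
    have : Epi ψ.τ₁ := h₁
    have : IsIso ψ.τ₂ := h₂
    have : Mono ψ.τ₃ := h₃
    exact ShortComplex.quasiIso_of_epi_of_isIso_of_mono ψ
  exact (NatIso.isIso_map_iff (homologyFunctorFactors ℋ n) φ).2 this


lemma isGE_double {X₀ X₁ : ℋ} (f : X₀ ⟶ X₁) (a b : ℤ) (h : (ComplexShape.up ℤ).Rel a b) :
    (Q.obj (HomologicalComplex.double f h)).IsGE a := by
  have : CochainComplex.IsStrictlyGE (HomologicalComplex.double f h) a := by
    rw [CochainComplex.isStrictlyGE_iff]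
    intro i hi
    have h' : a + 1 = b := h
    exact HomologicalComplex.isZero_double_X _ _ _ (by lia) (by lia)
  infer_instance

lemma isLE_double {X₀ X₁ : ℋ} (f : X₀ ⟶ X₁) (a b : ℤ) (h : (ComplexShape.up ℤ).Rel a b) :
    (Q.obj (HomologicalComplex.double f h)).IsLE b := by
  have : CochainComplex.IsStrictlyLE (HomologicalComplex.double f h) b := by
    rw [CochainComplex.isStrictlyLE_iff]
    intro i hi
    have h' : a + 1 = b := h
    exact HomologicalComplex.isZero_double_X _ _ _ (by lia) (by lia)
  infer_instance

lemma exists_from_double (K : CochainComplex ℋ ℤ) (n : ℤ) [K.IsStrictlyLE n] :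
    ∃ (D : DerivedCategory ℋ) (_ : D.IsGE (n - 1)) (_ : D.IsLE n) (φ : D ⟶ Q.obj K),
      IsIso ((homologyFunctor ℋ n).map φ) := by
  have hr : (ComplexShape.up ℤ).Rel (n - 1) n := by simp
  have hne : n - 1 ≠ n := by lia
  let φ : HomologicalComplex.double (K.d (n - 1) n) hr ⟶ K :=
    HomologicalComplex.mkHomFromDouble hr hne (𝟙 _) (𝟙 _) (by simp) (by
      intro k hk
      have hk' : n + 1 = k := hk
      exact (K.isZero_of_isStrictlyLE n k (by lia)).eq_of_tgt _ _)
  refine ⟨Q.obj (HomologicalComplex.double (K.d (n - 1) n) hr), isGE_double _ _ _ _,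
    isLE_double _ _ _ _, Q.map φ, ?_⟩
  apply isIso_homology_Q_map
  · rw [HomologicalComplex.mkHomFromDouble_f₀]
    infer_instance
  · rw [HomologicalComplex.mkHomFromDouble_f₁]
    infer_instance
  · constructor
    intro Z g h _
    exact (HomologicalComplex.isZero_double_X _ _ _ (by lia) (by lia)).eq_of_tgt _ _

open HomologicalComplex in
open scoped Classical in
lemma exists_hom_to_double (K : CochainComplex ℋ ℤ) (a b : ℤ) (h : (ComplexShape.up ℤ).Rel a b)
    [K.IsStrictlyGE a] :
    ∃ φ : K ⟶ double (K.d a b) h, IsIso (φ.f a) ∧ IsIso (φ.f b) := by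
  have hab : a + 1 = b := h
  have hne : a ≠ b := by lia
  let φ : K ⟶ double (K.d a b) h :=
    { f := fun k =>
        if hk₀ : k = a then
          eqToHom (by rw [hk₀]) ≫ (doubleXIso₀ (K.d a b) h).inv ≫ eqToHom (by rw [hk₀])
        else if hk₁ : k = b then
          eqToHom (by rw [hk₁]) ≫ (doubleXIso₁ (K.d a b) h hne).inv ≫ eqToHom (by rw [hk₁])
        else 0
      comm' := by
        intro k₀ k₁ hk
        have hk' : k₀ + 1 = k₁ := hk
        by_cases h₀ : k₀ = a
        · subst h₀
          obtain rfl : k₁ = b := by lia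
          simp [dif_neg hne.symm, double_d (K.d k₀ k₁) h hne]
        · by_cases h₁ : k₁ = a
          · exact (K.isZero_of_isStrictlyGE a k₀ (by lia)).eq_of_src _ _
          · exact (isZero_double_X _ h k₁ h₁ (by lia)).eq_of_tgt _ _ }
  refine ⟨φ, ?_, ?_⟩
  · simp only [φ]
    rw [dif_pos trivial]
    infer_instance
  · simp only [φ]
    rw [dif_neg hne.symm, dif_pos trivial]
    infer_instance

lemma exists_to_double (K : CochainComplex ℋ ℤ) (n : ℤ) [K.IsStrictlyGE n] :
    ∃ (D : DerivedCategory ℋ) (_ : D.IsGE n) (_ : D.IsLE (n + 1)) (φ : Q.obj K ⟶ D),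
      IsIso ((homologyFunctor ℋ n).map φ) := by
  have hr : (ComplexShape.up ℤ).Rel n (n + 1) := by simp
  obtain ⟨φ, h₁, h₂⟩ := exists_hom_to_double K n (n + 1) hr
  refine ⟨Q.obj (HomologicalComplex.double (K.d n (n + 1)) hr), isGE_double _ _ _ _,
    isLE_double _ _ _ _, Q.map φ, ?_⟩
  apply isIso_homology_Q_map
  · constructor
    intro Z g h _
    exact (HomologicalComplex.isZero_double_X _ _ _ (by lia) (by lia)).eq_of_src _ _
  · exact h₁
  · infer_instance

lemma exists_truncGEπ (E : DerivedCategory ℋ) (n : ℤ) :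
    ∃ π : E ⟶ (t.truncGE n).obj E, IsIso ((homologyFunctor ℋ n).map π) :=
  ⟨_, isIso_homology_truncGEπ E n⟩

lemma exists_truncLTι (E : DerivedCategory ℋ) (n : ℤ) :
    ∃ i : (t.truncLT (n + 1)).obj E ⟶ E, IsIso ((homologyFunctor ℋ n).map i) := by
  refine ⟨(t.truncLTι (n + 1)).app E, ?_⟩
  have := isIso_homology_truncLTι E (n + 1)
  rwa [show n + 1 - 1 = n by lia] at this

lemma isIso_map_section {C D : Type*} [Category C] [Category D] (F : C ⥤ D) {X Y : C}
    (f : X ⟶ Y) (g : Y ⟶ X) (h : f ≫ g = 𝟙 _) (hg : IsIso (F.map g)) : IsIso (F.map f) := by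
  have : IsIso (F.map f ≫ F.map g) := by
    rw [← F.map_comp, h]; infer_instance
  exact IsIso.of_isIso_comp_right _ (F.map g)

lemma isIso_map_retraction {C D : Type*} [Category C] [Category D] (F : C ⥤ D) {X Y : C}
    (f : X ⟶ Y) (g : Y ⟶ X) (h : f ≫ g = 𝟙 _) (hf : IsIso (F.map f)) : IsIso (F.map g) := by
  have : IsIso (F.map f ≫ F.map g) := by
    rw [← F.map_comp, h]; infer_instance
  exact IsIso.of_isIso_comp_left (F.map f) _

lemma exists_section_mor₂ (T : Triangle (DerivedCategory ℋ)) (hT : T ∈ distTriang _)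
    (h : T.mor₃ = 0) : ∃ σ : T.obj₃ ⟶ T.obj₂, σ ≫ T.mor₂ = 𝟙 _ := by
  obtain ⟨σ, hσ⟩ := Triangle.coyoneda_exact₃ T hT (𝟙 _) (by rw [h, comp_zero])
  exact ⟨σ, hσ.symm⟩

lemma exists_retraction_mor₁ (T : Triangle (DerivedCategory ℋ)) (hT : T ∈ distTriang _)
    (h : T.mor₃ = 0) : ∃ ρ : T.obj₂ ⟶ T.obj₁, T.mor₁ ≫ ρ = 𝟙 _ := by
  have h0 : T.invRotate.mor₁ = 0 := by
    simp [Triangle.invRotate, h]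
    rfl
  obtain ⟨ρ, hρ⟩ := Triangle.yoneda_exact₂ _ (inv_rot_of_distTriang _ hT) (𝟙 T.obj₁)
    ((congrArg (fun f => f ≫ 𝟙 T.obj₁) h0).trans zero_comp)
  exact ⟨ρ, hρ.symm⟩

lemma exists_section_truncGEπ (hH : Hereditary ℋ) (E : DerivedCategory ℋ) (n : ℤ)
    [E.IsGE (n - 1)] [E.IsLE n] :
    ∃ σ : (t.truncGE n).obj E ⟶ E, IsIso ((homologyFunctor ℋ n).map σ) := by
  obtain ⟨σ, hσ⟩ := exists_section_mor₂ _ (t.triangleLTGE_distinguished n E)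
    (exists_split_aux hH E n)
  exact ⟨σ, isIso_map_section (homologyFunctor ℋ n) _ _ hσ (isIso_homology_truncGEπ E n)⟩

lemma exists_retraction_truncLTι (hH : Hereditary ℋ) (E : DerivedCategory ℋ) (n : ℤ)
    [E.IsGE n] [E.IsLE (n + 1)] :
    ∃ ρ : E ⟶ (t.truncLT (n + 1)).obj E, IsIso ((homologyFunctor ℋ n).map ρ) := by
  have i3 : E.IsGE (n + 1 - 1) := by rwa [show n + 1 - 1 = n by lia]
  obtain ⟨ρ, hρ⟩ := exists_retraction_mor₁ _ (t.triangleLTGE_distinguished (n + 1) E)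
    (exists_split_aux hH E (n + 1))
  refine ⟨ρ, isIso_map_retraction (homologyFunctor ℋ n) _ _ hρ ?_⟩
  have := isIso_homology_truncLTι E (n + 1)
  rwa [show n + 1 - 1 = n by lia] at this

lemma exists_from_single (hH : Hereditary ℋ) (Z : DerivedCategory ℋ) (n : ℤ) :
    ∃ (Y : ℋ) (s : (singleFunctor ℋ n).obj Y ⟶ Z), IsIso ((homologyFunctor ℋ n).map s) := by
  have i0 : ((t.truncLT (n + 1)).obj Z).IsLE n := inferInstance
  obtain ⟨K, _, ⟨e⟩⟩ := exists_iso_Q_obj_of_isLE ((t.truncLT (n + 1)).obj Z) n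
  obtain ⟨D, _, _, φ, hφ⟩ := exists_from_double K n
  obtain ⟨i, hi⟩ := exists_truncLTι Z n
  obtain ⟨σ, hσ⟩ := exists_section_truncGEπ hH D n
  have i1 : ((t.truncGE n).obj D).IsGE n := inferInstance
  have i2 : ((t.truncGE n).obj D).IsLE n := inferInstance
  obtain ⟨Y, ⟨e'⟩⟩ := exists_iso_singleFunctor_obj_of_isGE_of_isLE ((t.truncGE n).obj D) n
  refine ⟨Y, e'.inv ≫ σ ≫ φ ≫ e.inv ≫ i, ?_⟩
  simp only [Functor.map_comp]
  infer_instance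

lemma exists_to_single (hH : Hereditary ℋ) (Z : DerivedCategory ℋ) (n : ℤ) :
    ∃ (Y : ℋ) (r : Z ⟶ (singleFunctor ℋ n).obj Y), IsIso ((homologyFunctor ℋ n).map r) := by
  have i0 : ((t.truncGE n).obj Z).IsGE n := inferInstance
  obtain ⟨K, _, ⟨e⟩⟩ := exists_iso_Q_obj_of_isGE ((t.truncGE n).obj Z) n
  obtain ⟨D, _, _, φ, hφ⟩ := exists_to_double K n
  obtain ⟨π, hπ⟩ := exists_truncGEπ Z n
  obtain ⟨ρ, hρ⟩ := exists_retraction_truncLTι hH D n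
  have i1 : ((t.truncLT (n + 1)).obj D).IsGE n := inferInstance
  have i2 : ((t.truncLT (n + 1)).obj D).IsLE n := inferInstance
  obtain ⟨Y, ⟨e'⟩⟩ := exists_iso_singleFunctor_obj_of_isGE_of_isLE ((t.truncLT (n + 1)).obj D) n
  refine ⟨Y, π ≫ e.hom ≫ φ ≫ ρ ≫ e'.hom, ?_⟩
  simp only [Functor.map_comp]
  infer_instance

lemma exists_retract_single (hH : Hereditary ℋ) (Z : DerivedCategory ℋ) (n : ℤ)
    (hZ : ¬ IsZero ((homologyFunctor ℋ n).obj Z)) :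
    ∃ (Y : ℋ) (s : (singleFunctor ℋ n).obj Y ⟶ Z) (r : Z ⟶ (singleFunctor ℋ n).obj Y),
      s ≫ r = 𝟙 _ ∧ r ≫ s ≠ 0 := by
  obtain ⟨Y, s, hs⟩ := exists_from_single hH Z n
  obtain ⟨Y', r, hr⟩ := exists_to_single hH Z n
  have hiso : IsIso (s ≫ r) := by
    rw [isIso_iff]
    intro m
    rcases lt_trichotomy m n with h | rfl | h
    · exact ⟨0, (isZero_of_isGE _ n m h).eq_of_src _ _, (isZero_of_isGE _ n m h).eq_of_src _ _⟩
    · rw [Functor.map_comp]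
      infer_instance
    · exact ⟨0, (isZero_of_isLE _ n m h).eq_of_src _ _, (isZero_of_isLE _ n m h).eq_of_src _ _⟩
  refine ⟨Y, s, r ≫ inv (s ≫ r), by
    rw [← Category.assoc]; exact IsIso.hom_inv_id (s ≫ r), ?_⟩
  intro h0
  apply hZ
  have h1 : (homologyFunctor ℋ n).map r ≫ (homologyFunctor ℋ n).map (inv (s ≫ r)) ≫
      (homologyFunctor ℋ n).map s = 0 := by
    rw [← Functor.map_comp, ← Functor.map_comp, ← Category.assoc, h0, Functor.map_zero]
  have h2 : IsIso ((homologyFunctor ℋ n).map r ≫ (homologyFunctor ℋ n).map (inv (s ≫ r)) ≫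
      (homologyFunctor ℋ n).map s) := inferInstance
  rw [h1] at h2
  rw [IsZero.iff_id_eq_zero, ← IsIso.hom_inv_id
    (0 : (homologyFunctor ℋ n).obj Z ⟶ (homologyFunctor ℋ n).obj Z), zero_comp]

lemma exists_homology_ne_zero (Z : DerivedCategory ℋ) (hZ : ¬ IsZero Z) :
    ∃ n : ℤ, ¬ IsZero ((homologyFunctor ℋ n).obj Z) := by
  by_contra! h
  apply hZ
  have : IsIso (0 : Z ⟶ Z) := by
    rw [isIso_iff]
    intro n
    exact ⟨0, (h n).eq_of_src _ _, (h n).eq_of_src _ _⟩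
  rw [IsZero.iff_id_eq_zero, ← IsIso.hom_inv_id (0 : Z ⟶ Z), zero_comp]


variable {𝒜 : Type u₁} [Category.{v₁} 𝒜]

/-- An instance-free version of indecomposability. -/
def Indec (X : 𝒜) : Prop :=
  ¬ IsZero X ∧ ∀ (Y : 𝒜) (s : Y ⟶ X) (r : X ⟶ Y), s ≫ r = 𝟙 Y → ¬ IsZero Y → r ≫ s = 𝟙 X

lemma indec_of_indecomposable [Abelian 𝒜] (z : HasZeroMorphisms 𝒜)
    (b : @HasBinaryBiproducts 𝒜 _ z) (X : 𝒜) (h : @Indecomposable 𝒜 _ z b X) : Indec X := by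
  obtain rfl : z = Preadditive.preadditiveHasZeroMorphisms := Subsingleton.elim _ _
  refine ⟨h.1, fun Y s r hsr hY => ?_⟩
  have : IsSplitMono s := IsSplitMono.mk' ⟨r, hsr⟩
  have hb := isBilimitBinaryBiconeOfIsSplitMonoOfCokernel (f := s) (cokernelIsCokernel s)
  have hZ := (h.2 _ _ (biprod.uniqueUpToIso _ _ hb)).resolve_left hY
  have hs : Epi s := Preadditive.epi_of_cokernel_zero (hZ.eq_of_tgt _ _)
  rw [← cancel_epi s, ← Category.assoc, hsr, Category.id_comp, Category.comp_id]

lemma exists_indec_of_map_ne_zero [Abelian 𝒜] (len : 𝒜 → ℕ)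
    (hlen : ∀ (X Y : 𝒜) (s : Y ⟶ X) (r : X ⟶ Y), s ≫ r = 𝟙 Y → r ≫ s ≠ 𝟙 X → len Y < len X) :
    ∀ (n : ℕ) (X : 𝒜), len X ≤ n → ∀ {B : Type w'} [AddCommGroup B] (φ : (X ⟶ X) →+ B),
      φ (𝟙 X) ≠ 0 → ∃ (Y : 𝒜) (s : Y ⟶ X) (r : X ⟶ Y), Indec Y ∧ s ≫ r = 𝟙 Y ∧ φ (r ≫ s) ≠ 0 := by
  intro n
  induction n using Nat.strong_induction_on with
  | _ n ih =>
  intro X hX B _ φ hφ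
  by_cases hi : Indec X
  · exact ⟨X, 𝟙 X, 𝟙 X, hi, by simp, by simpa using hφ⟩
  have hX0 : ¬ IsZero X := fun h0 => hφ (by rw [h0.eq_of_src (𝟙 X) 0, map_zero])
  have key : ∀ (Y : 𝒜) (s : Y ⟶ X) (r : X ⟶ Y), s ≫ r = 𝟙 Y → r ≫ s ≠ 𝟙 X → φ (r ≫ s) ≠ 0 →
      ∃ (Y : 𝒜) (s : Y ⟶ X) (r : X ⟶ Y), Indec Y ∧ s ≫ r = 𝟙 Y ∧ φ (r ≫ s) ≠ 0 := by
    intro Y s r h1 h2 h3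
    let ψ : (Y ⟶ Y) →+ B :=
      { toFun := fun f => φ (r ≫ f ≫ s)
        map_zero' := by simp
        map_add' := by intro f g; simp }
    obtain ⟨Y', s', r', hY', hs', hψ⟩ := ih (len Y) (lt_of_lt_of_le (hlen X Y s r h1 h2) hX) Y le_rfl ψ
      (by simpa [ψ] using h3)
    refine ⟨Y', s' ≫ s, r ≫ r', hY', ?_, ?_⟩
    · rw [Category.assoc, ← Category.assoc s, h1, Category.id_comp, hs']
    · simpa [ψ] using hψ
  obtain ⟨Y, s, r, hsr, hY, hne⟩ : ∃ (Y : 𝒜) (s : Y ⟶ X) (r : X ⟶ Y), s ≫ r = 𝟙 Y ∧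
      ¬ IsZero Y ∧ r ≫ s ≠ 𝟙 X := by
    by_contra! h
    exact hi ⟨hX0, h⟩
  by_cases h0 : φ (r ≫ s) = 0
  · have hid : (𝟙 X - r ≫ s) ≫ (𝟙 X - r ≫ s) = 𝟙 X - r ≫ s := by
      have : r ≫ s ≫ r ≫ s = r ≫ s := by rw [← Category.assoc s, hsr, Category.id_comp]
      simp [this]
    obtain ⟨Z, i, e, h1, h2⟩ := IsIdempotentComplete.idempotents_split X _ hid
    apply key Z i e h1
    · rw [h2]
      intro h3
      have h4 : r ≫ s = 0 := by simpa using h3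
      apply hY
      rw [IsZero.iff_id_eq_zero]
      calc 𝟙 Y = s ≫ (r ≫ s) ≫ r := by simp [hsr]
        _ = 0 := by rw [h4]; simp
    · rw [h2, map_sub, h0, sub_zero]
      exact hφ
  · exact key Y s r hsr hne h0

section Degree

variable [Abelian 𝒜] [HasDerivedCategory.{w} 𝒜]

lemma extNonzero_zero {X Y : 𝒜} (f : X ⟶ Y) (hf : f ≠ 0) : extNonzero 𝒜 X Y 0 := by
  let e := (shiftFunctorZero (DerivedCategory 𝒜) ℤ).app ((singleFunctor 𝒜 0).obj Y)
  refine ⟨(singleFunctor 𝒜 0).map f ≫ e.inv, ?_⟩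
  intro h
  apply hf
  have h' : (singleFunctor 𝒜 0).map f = 0 := by
    rw [← cancel_mono e.inv, zero_comp]
    exact h
  exact (singleFunctor 𝒜 0).map_injective (by simpa using h')

lemma exists_degree_aux (hH : Hereditary ℋ) (F : DerivedCategory 𝒜 ⥤ DerivedCategory ℋ)
    [F.IsEquivalence] (X : 𝒜) (hX : Indec X) :
    ∃ (m : ℤ) (Y : ℋ), Nonempty (F.obj ((singleFunctor 𝒜 0).obj X) ≅ (singleFunctor ℋ m).obj Y) := by
  let G := singleFunctor 𝒜 0 ⋙ F
  have : G.Full := inferInstance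
  have : G.Faithful := inferInstance
  have hz : ¬ IsZero (G.obj X) := by
    intro h
    apply hX.1
    have : 𝟙 X = 0 := G.map_injective (h.eq_of_src _ _)
    rwa [IsZero.iff_id_eq_zero]
  obtain ⟨n, hn⟩ := exists_homology_ne_zero _ hz
  obtain ⟨Y, s, r, hsr, hrs⟩ := exists_retract_single hH _ n hn
  obtain ⟨e, he⟩ := G.map_surjective (r ≫ s)
  have hid : e ≫ e = e := G.map_injective (by
    rw [G.map_comp, he, Category.assoc, ← Category.assoc s, hsr, Category.id_comp])
  obtain ⟨Z, i, p, h1, h2⟩ := IsIdempotentComplete.idempotents_split X e hid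
  have hZ : ¬ IsZero Z := by
    intro h
    apply hrs
    have he0 : e = 0 := by rw [← h2, h.eq_of_tgt p 0, zero_comp]
    rw [← he, he0]
    have : (singleFunctor 𝒜 0 ⋙ F).map (0 : X ⟶ X) = 0 := by
      rw [Functor.comp_map, Functor.map_zero, Functor.map_zero]
    exact this
  have h3 := hX.2 Z i p h1 hZ
  refine ⟨n, Y, ⟨⟨r, s, ?_, hsr⟩⟩⟩
  rw [← he, ← h2, h3]
  exact G.map_id X

lemma exists_degree (hph : IsPiecewiseHereditary.{w, w', v', u', v₁, u₁} 𝒜) :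
    ∃ deg : 𝒜 → ℤ, ∀ X Y : 𝒜, Indec X → Indec Y → ∀ d : ℤ, extNonzero 𝒜 X Y d →
      deg Y - deg X ≤ d ∧ d ≤ deg Y - deg X + 1 := by
  obtain ⟨ℋ, _, _, _, hH, ⟨E⟩⟩ := hph
  obtain ⟨F, _, _, _⟩ := E
  have h := exists_degree_aux hH F
  choose! m Y e using h
  refine ⟨m, fun X X' hX hX' d ⟨g, hg⟩ => ?_⟩
  obtain ⟨e₁⟩ := e X hX
  obtain ⟨e₂⟩ := e X' hX'
  let e₃ : ((singleFunctor ℋ (m X')).obj (Y X' hX'))⟦d⟧ ≅ (singleFunctor ℋ (m X' - d)).obj (Y X' hX') :=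
    ((singleFunctors ℋ).shiftIso d (m X' - d) (m X') (by lia)).app (Y X' hX')
  let e₄ : F.obj (((singleFunctor 𝒜 0).obj X')⟦d⟧) ≅ (singleFunctor ℋ (m X' - d)).obj (Y X' hX') :=
    (F.commShiftIso d).app _ ≪≫ (shiftFunctor _ d).mapIso e₂ ≪≫ e₃
  have hne : e₁.inv ≫ F.map g ≫ e₄.hom ≠ 0 := by
    intro h0
    apply hg
    have h1 : F.map g = 0 := by
      rw [← cancel_epi e₁.inv, ← cancel_mono e₄.hom]
      simpa using h0
    exact F.map_injective (by rw [h1, F.map_zero])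
  constructor
  · by_contra! hlt
    exact hne (single_hom_eq_zero_of_lt _ _ _ _ (by lia) _)
  · by_contra! hlt
    exact hne (single_hom_eq_zero_of_hereditary hH _ _ _ _ (by lia) _)

lemma reduce_extNonzero_left (len : 𝒜 → ℕ)
    (hlen : ∀ (X Y : 𝒜) (s : Y ⟶ X) (r : X ⟶ Y), s ≫ r = 𝟙 Y → r ≫ s ≠ 𝟙 X → len Y < len X)
    (X Y : 𝒜) (d : ℤ) (h : extNonzero 𝒜 X Y d) :
    ∃ X', Indec X' ∧ extNonzero 𝒜 X' Y d := by
  obtain ⟨g, hg⟩ := h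
  let φ : (X ⟶ X) →+ ((singleFunctor 𝒜 0).obj X ⟶ (((singleFunctor 𝒜 0).obj Y)⟦d⟧)) :=
    { toFun := fun f => (singleFunctor 𝒜 0).map f ≫ g
      map_zero' := by simp
      map_add' := by intro a b; simp }
  obtain ⟨X', s, r, hX', -, h⟩ := exists_indec_of_map_ne_zero len hlen _ X le_rfl φ
    (by simpa [φ] using hg)
  refine ⟨X', hX', (singleFunctor 𝒜 0).map s ≫ g, fun h0 => h ?_⟩
  simp only [φ, AddMonoidHom.coe_mk, ZeroHom.coe_mk, Functor.map_comp, Category.assoc, h0, comp_zero]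

lemma reduce_extNonzero_right (len : 𝒜 → ℕ)
    (hlen : ∀ (X Y : 𝒜) (s : Y ⟶ X) (r : X ⟶ Y), s ≫ r = 𝟙 Y → r ≫ s ≠ 𝟙 X → len Y < len X)
    (X Y : 𝒜) (d : ℤ) (h : extNonzero 𝒜 X Y d) :
    ∃ Y', Indec Y' ∧ extNonzero 𝒜 X Y' d := by
  obtain ⟨g, hg⟩ := h
  let φ : (Y ⟶ Y) →+ ((singleFunctor 𝒜 0).obj X ⟶ (((singleFunctor 𝒜 0).obj Y)⟦d⟧)) :=
    { toFun := fun f => g ≫ ((singleFunctor 𝒜 0).map f)⟦d⟧'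
      map_zero' := by simp
      map_add' := by intro a b; simp }
  obtain ⟨Y', s, r, hY', -, h⟩ := exists_indec_of_map_ne_zero len hlen _ Y le_rfl φ
    (by simpa [φ] using hg)
  refine ⟨Y', hY', g ≫ ((singleFunctor 𝒜 0).map r)⟦d⟧', fun h0 => h ?_⟩
  simp only [φ, AddMonoidHom.coe_mk, ZeroHom.coe_mk, Functor.map_comp]
  rw [← Category.assoc, h0, zero_comp]

lemma main_abstract (hph : IsPiecewiseHereditary.{w, w', v', u', v₁, u₁} 𝒜) (len : 𝒜 → ℕ)
    (hlen : ∀ (X Y : 𝒜) (s : Y ⟶ X) (r : X ⟶ Y), s ≫ r = 𝟙 Y → r ≫ s ≠ 𝟙 X → len Y < len X)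
    (M : 𝒜) (hM : Indec M)
    (hP : ∀ X : 𝒜, Indec X → ∃ (P : 𝒜) (f : P ⟶ X) (g : P ⟶ M), Indec P ∧ f ≠ 0 ∧ g ≠ 0)
    (hI : ∀ X : 𝒜, Indec X → ∃ (I : 𝒜) (f : X ⟶ I) (g : M ⟶ I), Indec I ∧ f ≠ 0 ∧ g ≠ 0) :
    gldim 𝒜 ≤ 3 ∧ ∀ X : 𝒜, Indec X → projDim 𝒜 X + injDim 𝒜 X ≤ 4 := by
  obtain ⟨deg, hdeg⟩ := exists_degree hph
  have hrange : ∀ X : 𝒜, Indec X → deg M - 1 ≤ deg X ∧ deg X ≤ deg M + 1 := by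
    intro X hX
    obtain ⟨P, f, g, hP1, hf, hg⟩ := hP X hX
    obtain ⟨I, f', g', hI1, hf', hg'⟩ := hI X hX
    have h1 := hdeg _ _ hP1 hX 0 (extNonzero_zero f hf)
    have h2 := hdeg _ _ hP1 hM 0 (extNonzero_zero g hg)
    have h3 := hdeg _ _ hX hI1 0 (extNonzero_zero f' hf')
    have h4 := hdeg _ _ hM hI1 0 (extNonzero_zero g' hg')
    lia
  constructor
  · refine iSup_le fun X => iSup_le fun d => iSup_le fun ⟨Y, h⟩ => ?_
    obtain ⟨X', hX', h'⟩ := reduce_extNonzero_left len hlen _ _ _ h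
    obtain ⟨Y', hY', h''⟩ := reduce_extNonzero_right len hlen _ _ _ h'
    have h1 := hdeg _ _ hX' hY' _ h''
    have h2 := hrange _ hX'
    have h3 := hrange _ hY'
    have : d ≤ 3 := by lia
    exact_mod_cast this
  · intro X hX
    have hX2 := hrange X hX
    obtain ⟨a, ha⟩ : ∃ a : ℕ, (a : ℤ) = deg M - deg X + 2 :=
      ⟨(deg M - deg X + 2).toNat, by lia⟩
    obtain ⟨b, hb⟩ : ∃ b : ℕ, (b : ℤ) = deg X - deg M + 2 :=
      ⟨(deg X - deg M + 2).toNat, by lia⟩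
    have h1 : projDim 𝒜 X ≤ (a : ℕ∞) := by
      refine iSup_le fun d => iSup_le fun ⟨Y, h⟩ => ?_
      obtain ⟨Y', hY', h''⟩ := reduce_extNonzero_right len hlen _ _ _ h
      have h1 := hdeg _ _ hX hY' _ h''
      have h3 := hrange _ hY'
      have : d ≤ a := by lia
      exact_mod_cast this
    have h2 : injDim 𝒜 X ≤ (b : ℕ∞) := by
      refine iSup_le fun d => iSup_le fun ⟨Y, h⟩ => ?_
      obtain ⟨Y', hY', h''⟩ := reduce_extNonzero_left len hlen _ _ _ h
      have h1 := hdeg _ _ hY' hX _ h''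
      have h3 := hrange _ hY'
      have : d ≤ b := by lia
      exact_mod_cast this
    have h3 : a + b = 4 := by lia
    calc projDim 𝒜 X + injDim 𝒜 X ≤ (a : ℕ∞) + (b : ℕ∞) := add_le_add h1 h2
      _ = 4 := by exact_mod_cast h3
      _ ≤ 4 := le_rfl

lemma exists_indec_left (len : 𝒜 → ℕ)
    (hlen : ∀ (X Y : 𝒜) (s : Y ⟶ X) (r : X ⟶ Y), s ≫ r = 𝟙 Y → r ≫ s ≠ 𝟙 X → len Y < len X)
    {X Y : 𝒜} (f : X ⟶ Y) (hf : f ≠ 0) :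
    ∃ (P : 𝒜) (s : P ⟶ X) (r : X ⟶ P), Indec P ∧ s ≫ r = 𝟙 P ∧ s ≫ f ≠ 0 := by
  let φ : (X ⟶ X) →+ (X ⟶ Y) :=
    { toFun := fun e => e ≫ f
      map_zero' := by simp
      map_add' := by intro a b; simp }
  obtain ⟨P, s, r, hP, h1, h2⟩ := exists_indec_of_map_ne_zero len hlen _ X le_rfl φ
    (by simpa [φ] using hf)
  refine ⟨P, s, r, hP, h1, fun h0 => h2 ?_⟩
  simp [φ, h0]

lemma exists_indec_right (len : 𝒜 → ℕ)
    (hlen : ∀ (X Y : 𝒜) (s : Y ⟶ X) (r : X ⟶ Y), s ≫ r = 𝟙 Y → r ≫ s ≠ 𝟙 X → len Y < len X)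
    {X Y : 𝒜} (f : X ⟶ Y) (hf : f ≠ 0) :
    ∃ (P : 𝒜) (s : P ⟶ Y) (r : Y ⟶ P), Indec P ∧ s ≫ r = 𝟙 P ∧ f ≫ r ≠ 0 := by
  let φ : (Y ⟶ Y) →+ (X ⟶ Y) :=
    { toFun := fun e => f ≫ e
      map_zero' := by simp
      map_add' := by intro a b; simp }
  obtain ⟨P, s, r, hP, h1, h2⟩ := exists_indec_of_map_ne_zero len hlen _ Y le_rfl φ
    (by simpa [φ] using hf)
  refine ⟨P, s, r, hP, h1, fun h0 => h2 ?_⟩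
  change f ≫ r ≫ s = 0
  rw [← Category.assoc, h0, zero_comp]

lemma main_abstract_two (hph : IsPiecewiseHereditary.{w, w', v', u', v₁, u₁} 𝒜) (len : 𝒜 → ℕ)
    (hlen : ∀ (X Y : 𝒜) (s : Y ⟶ X) (r : X ⟶ Y), s ≫ r = 𝟙 Y → r ≫ s ≠ 𝟙 X → len Y < len X)
    (M P₀ I₀ : 𝒜) (hM : Indec M)
    (hP : ∀ X : 𝒜, ¬ IsZero X → ∃ f : P₀ ⟶ X, f ≠ 0)
    (hP' : ∀ (P : 𝒜) (s : P ⟶ P₀) (r : P₀ ⟶ P), ¬ IsZero P → s ≫ r = 𝟙 P → ∃ f : P ⟶ M, f ≠ 0)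
    (hI : ∀ X : 𝒜, ¬ IsZero X → ∃ f : X ⟶ I₀, f ≠ 0)
    (hI' : ∀ (I : 𝒜) (s : I ⟶ I₀) (r : I₀ ⟶ I), ¬ IsZero I → s ≫ r = 𝟙 I →
      ∃ f : M ⟶ I, f ≠ 0) :
    gldim 𝒜 ≤ 3 ∧ ∀ X : 𝒜, Indec X → projDim 𝒜 X + injDim 𝒜 X ≤ 4 := by
  apply main_abstract hph len hlen M hM
  · intro X hX
    obtain ⟨f, hf⟩ := hP X hX.1
    obtain ⟨P, s, r, hPi, h1, h2⟩ := exists_indec_left len hlen f hf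
    obtain ⟨g, hg⟩ := hP' P s r hPi.1 h1
    exact ⟨P, s ≫ f, g, hPi, h2, hg⟩
  · intro X hX
    obtain ⟨f, hf⟩ := hI X hX.1
    obtain ⟨P, s, r, hPi, h1, h2⟩ := exists_indec_right len hlen f hf
    obtain ⟨g, hg⟩ := hI' P s r hPi.1 h1
    exact ⟨P, f ≫ r, g, hPi, h2, hg⟩

end Degree

end DerivedPart
section ModulePart

/-- The `k`-dual of `R`, as a left `R`-module. -/
def DualMod (k R : Type u) [Field k] [Ring R] [Algebra k R] : Type u := R →ₗ[k] k

section DualModInst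

variable (k R : Type u) [Field k] [Ring R] [Algebra k R]

noncomputable instance : AddCommGroup (DualMod k R) := inferInstanceAs (AddCommGroup (R →ₗ[k] k))

noncomputable instance : Module k (DualMod k R) := inferInstanceAs (Module k (R →ₗ[k] k))

/-- Evaluation of an element of the dual. -/
def DualMod.ev {k R : Type u} [Field k] [Ring R] [Algebra k R] (f : DualMod k R) : R →ₗ[k] k := f

variable {k R} in
lemma DualMod.ext' {f g : DualMod k R} (h : ∀ x, f.ev x = g.ev x) : f = g := LinearMap.ext h

noncomputable instance : SMul R (DualMod k R) :=
  ⟨fun r f => f.ev ∘ₗ LinearMap.mulRight k r⟩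

lemma DualMod.smul_ev (r : R) (f : DualMod k R) (x : R) : (r • f).ev x = f.ev (x * r) := rfl
lemma DualMod.add_ev (f g : DualMod k R) (x : R) : (f + g).ev x = f.ev x + g.ev x := rfl
lemma DualMod.zero_ev (x : R) : (0 : DualMod k R).ev x = 0 := rfl
lemma DualMod.ksmul_ev (c : k) (f : DualMod k R) (x : R) : (c • f).ev x = c * f.ev x := rfl

noncomputable instance : Module R (DualMod k R) where
  one_smul f := DualMod.ext' fun x => by simp [DualMod.smul_ev]
  mul_smul r s f := DualMod.ext' fun x => by simp [DualMod.smul_ev, mul_assoc]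
  smul_zero r := DualMod.ext' fun x => by simp [DualMod.smul_ev, DualMod.zero_ev]
  smul_add r f g := DualMod.ext' fun x => by simp [DualMod.smul_ev, DualMod.add_ev]
  add_smul r s f := DualMod.ext' fun x => by simp [DualMod.smul_ev, DualMod.add_ev, mul_add]
  zero_smul f := DualMod.ext' fun x => by simp [DualMod.smul_ev, DualMod.zero_ev]

instance : IsScalarTower k R (DualMod k R) :=
  ⟨fun c r f => DualMod.ext' fun x => by simp [DualMod.smul_ev, DualMod.ksmul_ev]⟩

instance [FiniteDimensional k R] : Module.Finite R (DualMod k R) := by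
  have : Module.Finite k (DualMod k R) := inferInstanceAs (Module.Finite k (R →ₗ[k] k))
  exact Module.Finite.of_restrictScalars_finite k R (DualMod k R)

variable {k R} in
/-- The `R`-linear map to the dual given by a functional. -/
def toDualMod {X : Type u} [AddCommGroup X] [Module R X] [Module k X] [IsScalarTower k R X]
    (φ : X →ₗ[k] k) : X →ₗ[R] DualMod k R where
  toFun x := φ ∘ₗ ((LinearMap.toSpanSingleton R X x).restrictScalars k)
  map_add' x y := DualMod.ext' fun a =>
    show φ (a • (x + y)) = φ (a • x) + φ (a • y) by rw [smul_add, map_add]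
  map_smul' r x := DualMod.ext' fun a =>
    show φ (a • r • x) = φ ((a * r) • x) by rw [mul_smul]

lemma toDualMod_ev {X : Type u} [AddCommGroup X] [Module R X] [Module k X] [IsScalarTower k R X]
    (φ : X →ₗ[k] k) (x : X) (a : R) : (toDualMod (R := R) φ x).ev a = φ (a • x) := rfl

end DualModInst

variable {R : Type u} [Ring R]

/-- Sincerity for left modules over an arbitrary ring. -/
def Sinc (R : Type u) [Ring R] (M : Type u) [AddCommGroup M] [Module R M] : Prop :=
  ∀ (S : Type u) [AddCommGroup S] [Module R S], IsSimpleModule R S →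
    ∃ (N N' : Submodule R M), N' ≤ N ∧ Nonempty ((↥N ⧸ N'.comap N.subtype) ≃ₗ[R] S)

lemma exists_map_from_projective {M P : Type u} [AddCommGroup M] [Module R M] [AddCommGroup P]
    [Module R P] [Module.Finite R P] [Nontrivial P] (hM : Sinc R M)
    (s : P →ₗ[R] R) (r : R →ₗ[R] P) (h : r ∘ₗ s = LinearMap.id) : ∃ f : P →ₗ[R] M, f ≠ 0 := by
  have hproj : Module.Projective R P := Module.Projective.of_split s r h
  obtain ⟨W, hW, -⟩ := (eq_top_or_exists_le_coatom (⊥ : Submodule R P)).resolve_left bot_ne_top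
  have hS : IsSimpleModule R (P ⧸ W) := isSimpleModule_iff_isCoatom.2 hW
  obtain ⟨N, N', -, ⟨e⟩⟩ := hM (P ⧸ W) hS
  obtain ⟨g, hg⟩ := Module.projective_lifting_property (N'.comap N.subtype).mkQ
    (e.symm.toLinearMap ∘ₗ W.mkQ) (Submodule.mkQ_surjective _)
  refine ⟨N.subtype ∘ₗ g, fun h0 => ?_⟩
  have hg0 : g = 0 := by
    ext x
    exact LinearMap.congr_fun h0 x
  have := hS.nontrivial
  obtain ⟨y, hy⟩ := exists_ne (0 : P ⧸ W)
  obtain ⟨x, rfl⟩ := W.mkQ_surjective y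
  have := LinearMap.congr_fun hg x
  rw [hg0] at this
  apply hy
  apply e.symm.injective
  simpa using this.symm

lemma exists_map_to_injective (k : Type u) [Field k] [Algebra k R]
    {M I : Type u} [AddCommGroup M] [Module R M] [AddCommGroup I]
    [Module R I] [IsArtinian R I] [Nontrivial I] (hM : Sinc R M)
    (s : I →ₗ[R] DualMod k R) (r : DualMod k R →ₗ[R] I) (h : r ∘ₗ s = LinearMap.id) :
    ∃ f : M →ₗ[R] I, f ≠ 0 := by
  let _ : Module k M := Module.compHom M (algebraMap k R)
  have : IsScalarTower k R M := ⟨fun c r m => by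
    rw [Algebra.smul_def, mul_smul]; rfl⟩
  obtain ⟨T, hT, -⟩ := (eq_bot_or_exists_atom_le (⊤ : Submodule R I)).resolve_left top_ne_bot
  have hS : IsSimpleModule R T := isSimpleModule_iff_isAtom.2 hT
  obtain ⟨N, N', -, ⟨e⟩⟩ := hM T hS
  let q : N →ₗ[R] I := T.subtype ∘ₗ e.toLinearMap ∘ₗ (N'.comap N.subtype).mkQ
  let ev1 : DualMod k R →ₗ[k] k :=
    { toFun := fun f => f.ev 1
      map_add' := fun _ _ => rfl
      map_smul' := fun _ _ => rfl }
  let ψ : (N.restrictScalars k) →ₗ[k] k := ev1 ∘ₗ ((s ∘ₗ q).restrictScalars k)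
  obtain ⟨g, hg⟩ := LinearMap.exists_extend ψ
  have key : ∀ n : N, r (toDualMod (R := R) g n) = q n := by
    intro n
    have : toDualMod (R := R) g n = s (q n) := by
      apply DualMod.ext'
      intro a
      rw [toDualMod_ev]
      have h1 := LinearMap.congr_fun hg (a • n)
      have h2 : ψ (a • n) = (s (q n)).ev a := by
        change (s (q (a • n))).ev 1 = _
        rw [map_smul, map_smul, DualMod.smul_ev, one_mul]
      rw [← h2]
      exact h1
    rw [this]
    exact LinearMap.congr_fun h (q n)
  refine ⟨r ∘ₗ toDualMod g, fun h0 => ?_⟩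
  have := hS.nontrivial
  obtain ⟨y, hy⟩ := exists_ne (0 : T)
  obtain ⟨x, hx⟩ := e.surjective y
  obtain ⟨n, rfl⟩ := (N'.comap N.subtype).mkQ_surjective x
  apply hy
  apply Subtype.ext
  rw [← hx]
  change q n = 0
  rw [← key]
  exact LinearMap.congr_fun h0 n

lemma exists_map_to_dual (k : Type u) [Field k] [Algebra k R]
    (M : Type u) [AddCommGroup M] [Module R M] [Nontrivial M] :
    ∃ f : M →ₗ[R] DualMod k R, f ≠ 0 := by
  let _ : Module k M := Module.compHom M (algebraMap k R)
  have : IsScalarTower k R M := ⟨fun c r m => by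
    rw [Algebra.smul_def, mul_smul]; rfl⟩
  obtain ⟨x, hx⟩ := exists_ne (0 : M)
  obtain ⟨φ, hφ⟩ : ∃ φ : Module.Dual k M, φ x ≠ 0 := by
    by_contra! h
    exact hx ((Module.forall_dual_apply_eq_zero_iff k x).1 h)
  refine ⟨toDualMod φ, fun h0 => hφ ?_⟩
  have := congrArg (fun f => DualMod.ev f 1) (LinearMap.congr_fun h0 x)
  simpa [toDualMod_ev, DualMod.zero_ev] using this

lemma exists_map_from_ring (M : Type u) [AddCommGroup M] [Module R M] [Nontrivial M] :
    ∃ f : R →ₗ[R] M, f ≠ 0 := by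
  obtain ⟨x, hx⟩ := exists_ne (0 : M)
  refine ⟨LinearMap.toSpanSingleton R M x, fun h0 => hx ?_⟩
  simpa using LinearMap.congr_fun h0 1

section CatPart

lemma hom_ne_zero_of_linear (z : HasZeroMorphisms (FGModuleCat.{u} R)) {X Y : FGModuleCat.{u} R}
    (f : X ⟶ Y) (hf : f.hom.hom ≠ 0) : f ≠ (z.zero X Y).zero := by
  intro h
  apply hf
  let z' : HasZeroMorphisms (FGModuleCat.{u} R) :=
    @Preadditive.preadditiveHasZeroMorphisms _ _ inferInstance
  obtain rfl : z = z' := Subsingleton.elim _ _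
  rw [h]
  rfl

lemma nontrivial_of_not_isZero (X : FGModuleCat.{u} R) (h : ¬ IsZero X) : Nontrivial X := by
  by_contra hX
  rw [not_nontrivial_iff_subsingleton] at hX
  apply h
  constructor
  · intro Y
    refine ⟨⟨⟨0⟩, fun f => ?_⟩⟩
    ext x
    have : x = 0 := Subsingleton.elim (α := X) _ _
    rw [this]
    exact (map_zero f.hom.hom).trans (map_zero (0 : X ⟶ Y).hom.hom).symm
  · intro Y
    refine ⟨⟨⟨0⟩, fun f => ?_⟩⟩
    ext x
    exact Subsingleton.elim (α := X) _ _

variable (R) in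
/-- The length of a finitely generated module, as a natural number. -/
noncomputable def len (X : FGModuleCat.{u} R) : ℕ := (Module.length R X).toNat

lemma len_lt [IsArtinianRing R] [IsNoetherianRing R] (X Y : FGModuleCat.{u} R) (s : Y ⟶ X)
    (r : X ⟶ Y) (h : s ≫ r = 𝟙 Y) (h' : r ≫ s ≠ 𝟙 X) : len R Y < len R X := by
  have h1 : ∀ y, r.hom.hom (s.hom.hom y) = y := fun y =>
    LinearMap.congr_fun (congrArg (fun f => f.hom.hom) h) y
  have hinj : Function.Injective s.hom.hom := fun a b hab => by rw [← h1 a, hab, h1]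
  have hne : LinearMap.range s.hom.hom ≠ ⊤ := by
    intro htop
    apply h'
    ext x
    obtain ⟨y, rfl⟩ := LinearMap.range_eq_top.1 htop x
    change s.hom.hom (r.hom.hom (s.hom.hom y)) = s.hom.hom y
    rw [h1]
  have hX : IsArtinian R X := inferInstance
  have hX' : IsNoetherian R X := inferInstance
  have h2 : Module.length R Y < Module.length R X := by
    have h3 := Submodule.length_lt hne
    rwa [← (LinearEquiv.ofInjective s.hom.hom hinj).length_eq] at h3
  unfold len
  rw [← ENat.coe_lt_coe, ENat.coe_toNat (h2.trans_le le_top).ne, ENat.coe_toNat Module.length_ne_top]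
  exact h2

lemma main_module (k : Type u) [Field k] [Algebra k R] [FiniteDimensional k R]
    [Abelian (FGModuleCat.{u} R)] [HasDerivedCategory.{w} (FGModuleCat.{u} R)]
    (hph : IsPiecewiseHereditary.{w, w', v', u', u, u+1} (FGModuleCat.{u} R))
    (M : FGModuleCat.{u} R) (hM : Indec M) (hS : Sinc R M) :
    gldim (FGModuleCat.{u} R) ≤ 3 ∧ ∀ X : FGModuleCat.{u} R, Indec X →
      projDim (FGModuleCat.{u} R) X + injDim (FGModuleCat.{u} R) X ≤ 4 := by
  have : IsArtinianRing R := IsArtinianRing.of_finite k R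
  have : IsNoetherianRing R := IsNoetherianRing.of_finite k R
  apply main_abstract_two hph (len R) len_lt M (FGModuleCat.of R R)
    (FGModuleCat.of R (DualMod k R)) hM
  · intro X hX
    have := nontrivial_of_not_isZero X hX
    obtain ⟨f, hf⟩ := exists_map_from_ring (R := R) X
    exact ⟨FGModuleCat.ofHom f, hom_ne_zero_of_linear _ _ hf⟩
  · intro P s r hP h
    have := nontrivial_of_not_isZero P hP
    obtain ⟨f, hf⟩ := exists_map_from_projective hS s.hom.hom r.hom.hom
      (congrArg (fun f => f.hom.hom) h)
    exact ⟨FGModuleCat.ofHom f, hom_ne_zero_of_linear _ _ hf⟩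
  · intro X hX
    have := nontrivial_of_not_isZero X hX
    obtain ⟨f, hf⟩ := exists_map_to_dual (R := R) k X
    exact ⟨FGModuleCat.ofHom f, hom_ne_zero_of_linear _ _ hf⟩
  · intro P s r hP h
    have := nontrivial_of_not_isZero P hP
    obtain ⟨f, hf⟩ := exists_map_to_injective k hS s.hom.hom r.hom.hom
      (congrArg (fun f => f.hom.hom) h)
    exact ⟨FGModuleCat.ofHom f, hom_ne_zero_of_linear _ _ hf⟩

end CatPart

end ModulePart

variable (A : Type u) [Ring A]

/-- A finite dimensional right `A`-module `M` is sincere if every simple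
(right) `A`-module occurs as a composition factor of `M`. -/
def IsSincere (M : FGModuleCat Aᵐᵒᵖ) : Prop :=
  ∀ (S : Type u) [AddCommGroup S] [Module Aᵐᵒᵖ S], IsSimpleModule Aᵐᵒᵖ S →
    ∃ (N N' : Submodule Aᵐᵒᵖ M), N' ≤ N ∧
      Nonempty ((↥N ⧸ N'.comap N.subtype) ≃ₗ[Aᵐᵒᵖ] S)

variable [Abelian (FGModuleCat Aᵐᵒᵖ)]

noncomputable instance : HasBinaryBiproducts (FGModuleCat Aᵐᵒᵖ) :=
  HasBinaryBiproducts.of_hasBinaryProducts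

theorem gldim_le_three_of_piecewiseHereditary_sincere
    (k : Type u) [Field k] [Algebra k A] [FiniteDimensional k A]
    [HasDerivedCategory.{w} (FGModuleCat Aᵐᵒᵖ)]
    (hph : IsPiecewiseHereditary.{w, w', v', u', u, u+1} (FGModuleCat Aᵐᵒᵖ))
    (hsincere : ∃ M : FGModuleCat Aᵐᵒᵖ, Indecomposable M ∧ IsSincere A M) :
    gldim (FGModuleCat Aᵐᵒᵖ) ≤ 3 ∧
      ∀ Q : FGModuleCat Aᵐᵒᵖ, Indecomposable Q →
        projDim (FGModuleCat Aᵐᵒᵖ) Q + injDim (FGModuleCat Aᵐᵒᵖ) Q ≤ 4 := by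
  have : FiniteDimensional k Aᵐᵒᵖ := Module.Finite.equiv (MulOpposite.opLinearEquiv k)
  obtain ⟨M, hM, hS⟩ := hsincere
  have h := main_module k hph M (indec_of_indecomposable _ _ M hM) hS
  exact ⟨h.1, fun Q hQ => h.2 Q (indec_of_indecomposable _ _ Q hQ)⟩

end PiecewiseHereditaryPaper
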